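/- In the sparse regime, the higher criticism test achieves the detection boundary: if ε_n = n^{-β} with β ∈ (1/2,1) fixed and ρ_n = 1 − n^{-γ} with γ > 0 fixed such that γ > 4(β − 1/2), then the sequence of tests that rejects when HC_n ≥ log n is asymptotically powerful, where HC_n := sup_{u ≥ 0} √n (F_n(u) − Ψ(u)) / √(Ψ(u)(1 − Ψ(u))), F_n is the empirical distribution function of |U₁|,…,|Uₙ| with U_i := (X_i − Y_i)/√2, and Ψ(u) := 2Φ(u) − 1. -/

import Mathlib

open MeasureTheory ProbabilityTheory Real Filter Topology

noncomputable section

/-- The standard normal distribution on ℝ. -/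
def stdGauss : Measure ℝ := gaussianReal 0 1

/-- Two independent standard normals. -/
def stdGauss2 : Measure (ℝ × ℝ) := stdGauss.prod stdGauss

/-- `N(0, Σ_ρ)`: the centered bivariate normal with unit marginal variances and
correlation `ρ`, i.e. the law of `(Z₁, ρ Z₁ + √(1-ρ²) Z₂)` for independent standard
normal `Z₁, Z₂`. -/
def biNormal (ρ : ℝ) : Measure (ℝ × ℝ) :=
  stdGauss2.map fun z => (z.1, ρ * z.1 + Real.sqrt (1 - ρ ^ 2) * z.2)

/-- The contamination mixture `P_{ε,ρ} = (1-ε) N(0,Σ₀) + ε N(0,Σ_ρ)`. -/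
def mixture (ε ρ : ℝ) : Measure (ℝ × ℝ) :=
  ENNReal.ofReal (1 - ε) • biNormal 0 + ENNReal.ofReal ε • biNormal ρ

/-- The `n`-fold product (i.i.d.) measure. -/
def iid (n : ℕ) (μ : Measure (ℝ × ℝ)) : Measure (Fin n → ℝ × ℝ) :=
  Measure.pi fun _ => μ
/-- The standard normal distribution function. -/
def Phi (t : ℝ) : ℝ := (stdGauss (Set.Iic t)).toReal

/-- `Ψ(t) = 2Φ(t) - 1`, the distribution function of the absolute value of a standard
normal. -/
def Psi (t : ℝ) : ℝ := 2 * Phi t - 1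

/-- The pairwise differences `Uᵢ = (Xᵢ - Yᵢ)/√2`. -/
def pairDiff (n : ℕ) (x : Fin n → ℝ × ℝ) (i : Fin n) : ℝ :=
  ((x i).1 - (x i).2) / Real.sqrt 2

/-- The empirical distribution function of `|U₁|, …, |Uₙ|`. -/
def empCdf (n : ℕ) (x : Fin n → ℝ × ℝ) (u : ℝ) : ℝ :=
  (Finset.univ.filter fun i : Fin n => |pairDiff n x i| ≤ u).card / n

/-- The higher criticism statistic
`HCₙ = sup_{u ≥ 0} √n (Fₙ(u) - Ψ(u)) / √(Ψ(u)(1-Ψ(u)))`. -/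
def HCstat (n : ℕ) (x : Fin n → ℝ × ℝ) : ℝ :=
  ⨆ u : {u : ℝ // 0 ≤ u},
    Real.sqrt n * (empCdf n x u.1 - Psi u.1) / Real.sqrt (Psi u.1 * (1 - Psi u.1))


section Counts

variable {Ω : Type*}

/-- The number of coordinates of `x` that fall in `S`. -/
def hits {n : ℕ} (S : Set Ω) (x : Fin n → Ω) : ℝ := ∑ i, S.indicator (fun _ => (1 : ℝ)) (x i)

lemma indicator_one_nonneg (S : Set Ω) (ω : Ω) : 0 ≤ S.indicator (fun _ => (1 : ℝ)) ω :=
  Set.indicator_nonneg (fun _ _ => zero_le_one) _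

lemma hits_nonneg {n : ℕ} (S : Set Ω) (x : Fin n → Ω) : 0 ≤ hits S x :=
  Finset.sum_nonneg fun _ _ => indicator_one_nonneg S _

lemma hits_le {n : ℕ} (S : Set Ω) (x : Fin n → Ω) : hits S x ≤ n := by
  calc hits S x ≤ ∑ _i : Fin n, (1 : ℝ) :=
        Finset.sum_le_sum fun i _ => Set.indicator_le_self' (fun _ _ => zero_le_one) _
    _ = n := by simp

lemma hits_mono {n : ℕ} {S T : Set Ω} (h : S ⊆ T) (x : Fin n → Ω) : hits S x ≤ hits T x :=
  Finset.sum_le_sum fun _ _ =>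
    Set.indicator_le_indicator_of_subset h (fun _ => zero_le_one) _

lemma hits_eq_zero {n : ℕ} {S : Set Ω} {x : Fin n → Ω} (h : hits S x < 1) : hits S x = 0 := by
  refine Finset.sum_eq_zero fun i _ => ?_
  by_contra hi
  have hmem : x i ∈ S := Set.mem_of_indicator_ne_zero hi
  have : S.indicator (fun _ => (1 : ℝ)) (x i) ≤ hits S x :=
    Finset.single_le_sum (f := fun i => S.indicator (fun _ => (1 : ℝ)) (x i))
      (fun j _ => indicator_one_nonneg S _) (Finset.mem_univ i)
  rw [Set.indicator_of_mem hmem] at this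
  linarith

variable [MeasurableSpace Ω]

lemma measurable_indicator_one {S : Set Ω} (hS : MeasurableSet S) :
    Measurable (S.indicator fun _ => (1 : ℝ)) := measurable_const.indicator hS

/-- Markov's inequality for the number of hits. -/
lemma measureReal_le_hits_le {n : ℕ} (μ : Measure Ω) [IsProbabilityMeasure μ] {S : Set Ω}
    (hS : MeasurableSet S) {m : ℝ} (hm : 0 < m) :
    (Measure.pi fun _ : Fin n => μ).real {x | m ≤ hits S x} ≤ n * μ.real S / m := by
  have hint : ∀ i : Fin n, Integrable (fun x : Fin n → Ω => S.indicator (fun _ => (1 : ℝ)) (x i))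
      (Measure.pi fun _ : Fin n => μ) := fun i =>
    integrable_comp_eval (μ := fun _ : Fin n => μ) ((integrable_const (1 : ℝ)).indicator hS)
  have hmean : ∫ x, hits S x ∂(Measure.pi fun _ : Fin n => μ) = n * μ.real S := by
    simp only [hits]
    rw [integral_finsetSum _ fun i _ => hint i]
    have : ∀ i : Fin n, ∫ x : Fin n → Ω, S.indicator (fun _ => (1 : ℝ)) (x i)
        ∂(Measure.pi fun _ : Fin n => μ) = μ.real S := fun i => by
      rw [integral_comp_eval (μ := fun _ : Fin n => μ) (i := i)
        (measurable_indicator_one hS).aestronglyMeasurable, integral_indicator_const _ hS]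
      simp
    simp [this]
  rw [le_div_iff₀ hm, ← hmean, mul_comm]
  exact mul_meas_ge_le_integral_of_nonneg (ae_of_all _ fun x => hits_nonneg S x)
    (integrable_finsetSum _ fun i _ => hint i) m

/-- The constant in the quadratic bound on the exponential over `[-16, 16]`. -/
def expConst : ℝ := Real.exp 16

lemma one_le_expConst : 1 ≤ expConst := Real.one_le_exp (by norm_num)

lemma exp_le_quadratic {x : ℝ} (hx : x ≤ 16) :
    Real.exp x ≤ 1 + x + expConst * x ^ 2 := by
  have hK := one_le_expConst
  rcases le_or_gt |x| 1 with h | h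
  · have := (abs_le.mp (Real.abs_exp_sub_one_sub_id_le h)).2
    nlinarith [sq_nonneg x]
  · rcases lt_abs.mp h with h | h
    · have : Real.exp x ≤ expConst := Real.exp_le_exp.mpr hx
      nlinarith [mul_nonneg (zero_le_one.trans hK) (show 0 ≤ x ^ 2 - 1 by nlinarith)]
    · have : Real.exp x ≤ 1 := Real.exp_le_one_iff.mpr (by linarith)
      nlinarith [sq_nonneg x]

/-- A two-sided Bernstein-type bound on the centred number of hits. -/
lemma measureReal_le_mul_hits_sub_le {n : ℕ} (μ : Measure Ω) [IsProbabilityMeasure μ] {S : Set Ω}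
    (hS : MeasurableSet S) {t : ℝ} (ht : |t| ≤ 16) (b : ℝ) :
    (Measure.pi fun _ : Fin n => μ).real {x | b ≤ t * (hits S x - n * μ.real S)} ≤
      Real.exp (expConst * (n * μ.real S * (1 - μ.real S)) * t ^ 2 - b) := by
  set p := μ.real S with hp
  have hp0 : 0 ≤ p := measureReal_nonneg
  have hp1 : p ≤ 1 := measureReal_le_one
  set f : Ω → ℝ := fun ω => Real.exp (t * (S.indicator (fun _ => (1 : ℝ)) ω - p)) with hf
  have hprod : ∀ x : Fin n → Ω, Real.exp (1 * (t * (hits S x - n * p))) = ∏ i, f (x i) := by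
    intro x
    rw [hf, ← Real.exp_sum, ← Finset.mul_sum, Finset.sum_sub_distrib]
    simp [hits]
  have hfm : Measurable f := by
    have := measurable_indicator_one hS
    fun_prop
  have hfb : ∀ ω, f ω ≤ Real.exp 16 := fun ω => by
    refine Real.exp_le_exp.mpr ((le_abs_self _).trans ?_)
    rw [abs_mul]
    have h1 := indicator_one_nonneg S ω
    have h2 : S.indicator (fun _ => (1 : ℝ)) ω ≤ 1 :=
      Set.indicator_le_self' (fun _ _ => zero_le_one) _
    have : |S.indicator (fun _ => (1 : ℝ)) ω - p| ≤ 1 := abs_le.mpr ⟨by linarith, by linarith⟩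
    nlinarith [abs_nonneg t]
  have hfint : ∫ ω, f ω ∂μ = p * Real.exp (t * (1 - p)) + (1 - p) * Real.exp (t * (0 - p)) := by
    have : f = fun ω => S.indicator
        (fun _ => Real.exp (t * (1 - p)) - Real.exp (t * (0 - p))) ω + Real.exp (t * (0 - p)) := by
      ext ω
      by_cases h : ω ∈ S <;> simp [hf, h]
    rw [this, integral_add ((integrable_const _).indicator hS) (integrable_const _),
      integral_indicator_const _ hS]
    simp
    ring
  have habs := abs_le.mp ht
  have hle : ∫ ω, f ω ∂μ ≤ Real.exp (expConst * (p * (1 - p)) * t ^ 2) := by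
    have h1 := exp_le_quadratic (x := t * (1 - p)) (by nlinarith)
    have h2 := exp_le_quadratic (x := t * (0 - p)) (by nlinarith)
    have h3 := Real.add_one_le_exp (expConst * (p * (1 - p)) * t ^ 2)
    rw [hfint]
    nlinarith [mul_le_mul_of_nonneg_left h1 hp0,
      mul_le_mul_of_nonneg_left h2 (sub_nonneg.mpr hp1)]
  have hint : Integrable (fun x : Fin n → Ω => Real.exp (1 * (t * (hits S x - n * p))))
      (Measure.pi fun _ : Fin n => μ) := by
    simp only [hprod]
    refine Integrable.of_bound (C := (Real.exp 16) ^ n) ?_ (ae_of_all _ fun x => ?_)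
    · exact (Finset.measurable_prod _ fun i _ =>
        hfm.comp (measurable_pi_apply i)).aestronglyMeasurable
    · rw [Real.norm_of_nonneg (Finset.prod_nonneg fun i _ => (Real.exp_pos _).le)]
      refine (Finset.prod_le_prod (fun i _ => (Real.exp_pos _).le) fun i _ => hfb (x i)).trans ?_
      simp
  refine (measure_ge_le_exp_mul_mgf (X := fun x => t * (hits S x - n * p)) b
    zero_le_one hint).trans ?_
  have hmgf : mgf (fun x => t * (hits S x - n * p)) (Measure.pi fun _ : Fin n => μ) 1 =
      (∫ ω, f ω ∂μ) ^ n := by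
    simp only [mgf, hprod]
    rw [integral_fintype_prod_eq_pow]
    simp
  rw [hmgf, show expConst * (n * p * (1 - p)) * t ^ 2 - b =
    -1 * b + n * (expConst * (p * (1 - p)) * t ^ 2) by ring, Real.exp_add, Real.exp_nat_mul]
  gcongr

end Counts

section Gaussian

instance : IsProbabilityMeasure stdGauss := by unfold stdGauss; infer_instance
instance : IsProbabilityMeasure stdGauss2 := by unfold stdGauss2; infer_instance

instance : NullSingletonClass stdGauss := nullSingletonClass_gaussianReal one_ne_zero

lemma measurable_biNormal_map (ρ : ℝ) : Measurable
    fun z : ℝ × ℝ => (z.1, ρ * z.1 + Real.sqrt (1 - ρ ^ 2) * z.2) := by fun_prop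

instance (ρ : ℝ) : IsProbabilityMeasure (biNormal ρ) :=
  Measure.isProbabilityMeasure_map (measurable_biNormal_map ρ).aemeasurable

lemma Phi_eq_cdf : Phi = cdf stdGauss := by
  ext t
  rw [cdf_eq_real]; rfl

lemma Psi_mono : Monotone Psi := fun a b h => by
  have := monotone_cdf stdGauss h
  simp only [Psi, Phi_eq_cdf]
  linarith

lemma Psi_le_one (u : ℝ) : Psi u ≤ 1 := by
  have := cdf_le_one stdGauss u
  simp only [Psi, Phi_eq_cdf]
  linarith

lemma tendsto_Psi_atTop : Tendsto Psi atTop (𝓝 1) := by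
  have := ((tendsto_cdf_atTop stdGauss).const_mul 2).sub_const 1
  rw [← Phi_eq_cdf] at this
  rw [show (2 : ℝ) * 1 - 1 = 1 by norm_num] at this
  exact this

lemma stdGauss_map_neg : stdGauss.map (fun x => -x) = stdGauss := by
  simp [stdGauss, gaussianReal_map_neg]

/-- `Ψ` is the distribution function of `|Z|`. -/
lemma measureReal_abs_le {u : ℝ} (hu : 0 ≤ u) : stdGauss.real {z | |z| ≤ u} = Psi u := by
  have hset : {z : ℝ | |z| ≤ u} = Set.Iic u \ Set.Iio (-u) := by
    ext z
    simp [abs_le, and_comm]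
  have hneg : stdGauss.real (Set.Iio (-u)) = 1 - Phi u := by
    rw [← stdGauss_map_neg, map_measureReal_apply measurable_neg measurableSet_Iio]
    have : (fun x : ℝ => -x) ⁻¹' Set.Iio (-u) = (Set.Iic u)ᶜ := by
      ext; simp
    rw [this, probReal_compl_eq_one_sub measurableSet_Iic]
    rfl
  rw [hset, measureReal_sdiff _ measurableSet_Iio, hneg]
  · simp only [Psi, Phi, measureReal_def]
    ring
  · intro z hz
    simp only [Set.mem_Iio, Set.mem_Iic] at *
    linarith

lemma Psi_zero : Psi 0 = 0 := by
  rw [← measureReal_abs_le le_rfl]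
  simp [measureReal_def]

lemma Psi_nonneg {u : ℝ} (hu : 0 ≤ u) : 0 ≤ Psi u := by
  rw [← measureReal_abs_le hu]; exact measureReal_nonneg

lemma stdGauss_pos {s : Set ℝ} (hs : volume s ≠ 0) : 0 < stdGauss.real s := by
  refine ENNReal.toReal_pos (fun h => hs ?_) (measure_ne_top _ _)
  exact gaussianReal_absolutelyContinuous' 0 one_ne_zero h

lemma Psi_pos {u : ℝ} (hu : 0 < u) : 0 < Psi u := by
  rw [← measureReal_abs_le hu.le]
  refine stdGauss_pos ?_
  have : {z : ℝ | |z| ≤ u} = Set.Icc (-u) u := by ext; simp [abs_le]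
  rw [this, Real.volume_Icc]
  simpa using by linarith

lemma gaussianPDFReal_le_half (x : ℝ) : gaussianPDFReal 0 1 x ≤ 1 / 2 := by
  rw [gaussianPDFReal]
  have h1 : 2 ≤ √(2 * π * ((1 : NNReal) : ℝ)) := by
    refine Real.le_sqrt_of_sq_le ?_
    have := Real.pi_gt_three
    norm_num
    linarith
  have h2 : Real.exp (-(x - 0) ^ 2 / (2 * ((1 : NNReal) : ℝ))) ≤ 1 := by
    refine Real.exp_le_one_iff.mpr ?_
    simp
    nlinarith [sq_nonneg x]
  have h3 : (√(2 * π * ((1 : NNReal) : ℝ)))⁻¹ ≤ 1 / 2 := by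
    rw [one_div]
    exact inv_anti₀ two_pos h1
  have := Real.exp_pos (-(x - 0) ^ 2 / (2 * ((1 : NNReal) : ℝ)))
  nlinarith

lemma Psi_sub_le {a b : ℝ} (hab : a ≤ b) : Psi b - Psi a ≤ b - a := by
  have h1 : Phi b - Phi a = stdGauss.real (Set.Ioc a b) := by
    rw [← Set.Iic_sdiff_Iic, measureReal_sdiff (Set.Iic_subset_Iic.mpr hab) measurableSet_Iic]
    rfl
  have h2 : stdGauss (Set.Ioc a b) ≤ ENNReal.ofReal ((b - a) / 2) := by
    rw [stdGauss, gaussianReal_apply 0 one_ne_zero]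
    calc ∫⁻ x in Set.Ioc a b, gaussianPDF 0 1 x ≤ ∫⁻ _x in Set.Ioc a b, ENNReal.ofReal (1 / 2) :=
          lintegral_mono fun x => ENNReal.ofReal_le_ofReal (gaussianPDFReal_le_half x)
      _ = ENNReal.ofReal ((b - a) / 2) := by
          rw [setLIntegral_const, Real.volume_Ioc, ← ENNReal.ofReal_mul (by norm_num)]
          congr 1; ring
  have h3 : stdGauss.real (Set.Ioc a b) ≤ (b - a) / 2 :=
    ENNReal.toReal_le_of_le_ofReal (by linarith) h2
  simp only [Psi]
  linarith

lemma Psi_le_self {u : ℝ} (hu : 0 ≤ u) : Psi u ≤ u := by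
  have := Psi_sub_le hu
  rw [Psi_zero] at this
  linarith

lemma continuous_Psi : Continuous Psi := by
  have : LipschitzWith 1 Psi := LipschitzWith.of_le_add fun a b => by
    rcases le_total a b with h | h
    · have := Psi_mono h
      have := dist_nonneg (x := a) (y := b)
      linarith
    · have := Psi_sub_le h
      rw [Real.dist_eq, abs_of_nonneg (by linarith)]
      linarith
  exact this.continuous

lemma exists_Psi_eq {p : ℝ} (h0 : 0 ≤ p) (h1 : p < 1) : ∃ u, 0 ≤ u ∧ Psi u = p := by
  obtain ⟨b, hb, hb0⟩ :=
    ((tendsto_Psi_atTop.eventually_const_lt h1).and (eventually_ge_atTop 0)).exists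
  obtain ⟨u, hu, h⟩ := intermediate_value_Icc hb0 continuous_Psi.continuousOn
    (show p ∈ Set.Icc (Psi 0) (Psi b) from ⟨by rw [Psi_zero]; exact h0, hb.le⟩)
  exact ⟨u, hu.1, h⟩

/-- The points of the plane with `|x - y| / √2 ≤ u`. -/
def strip (u : ℝ) : Set (ℝ × ℝ) := {z | |(z.1 - z.2) / Real.sqrt 2| ≤ u}

lemma measurableSet_strip (u : ℝ) : MeasurableSet (strip u) :=
  measurableSet_le (by fun_prop) (by fun_prop)

lemma biNormal_map_diff {ρ : ℝ} (h0 : 0 ≤ ρ) (h1 : ρ ≤ 1) :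
    (biNormal ρ).map (fun z => (z.1 - z.2) / Real.sqrt 2) =
      stdGauss.map (fun z => Real.sqrt (1 - ρ) * z) := by
  have hs : 0 ≤ 1 - ρ ^ 2 := by nlinarith
  have h2 : Real.sqrt 2 ≠ 0 := by positivity
  rw [biNormal, Measure.map_map (by fun_prop) (measurable_biNormal_map ρ)]
  have hcomp : (fun z : ℝ × ℝ => (z.1 - z.2) / Real.sqrt 2) ∘
        (fun z : ℝ × ℝ => (z.1, ρ * z.1 + Real.sqrt (1 - ρ ^ 2) * z.2)) =
      (fun z : ℝ × ℝ => z.1 + z.2) ∘ Prod.map (fun z => (1 - ρ) / Real.sqrt 2 * z)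
        (fun z => -Real.sqrt (1 - ρ ^ 2) / Real.sqrt 2 * z) := by
    ext z
    simp only [Function.comp, Prod.map]
    field_simp
    ring
  rw [hcomp, ← Measure.map_map (by fun_prop) (by fun_prop), stdGauss2,
    ← Measure.map_prod_map _ _ (by fun_prop) (by fun_prop)]
  change Measure.conv _ _ = _
  rw [stdGauss, gaussianReal_map_const_mul, gaussianReal_map_const_mul,
    gaussianReal_map_const_mul, gaussianReal_conv_gaussianReal]
  congr 1
  · simp
  · ext
    simp only [mul_one, NNReal.coe_add, NNReal.coe_mk]
    rw [div_pow, div_pow, neg_sq, Real.sq_sqrt hs, Real.sq_sqrt two_pos.le,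
      Real.sq_sqrt (by linarith)]
    ring

lemma biNormal_strip {ρ u : ℝ} (h0 : 0 ≤ ρ) (h1 : ρ < 1) (hu : 0 ≤ u) :
    (biNormal ρ).real (strip u) = Psi (u / Real.sqrt (1 - ρ)) := by
  have hr : 0 < Real.sqrt (1 - ρ) := Real.sqrt_pos.mpr (by linarith)
  have hm : MeasurableSet {z : ℝ | |z| ≤ u} := measurableSet_le (by fun_prop) (by fun_prop)
  rw [← measureReal_abs_le (by positivity)]
  have : strip u = (fun z : ℝ × ℝ => (z.1 - z.2) / Real.sqrt 2) ⁻¹' {z | |z| ≤ u} := rfl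
  rw [this, ← map_measureReal_apply (by fun_prop) hm, biNormal_map_diff h0 h1.le,
    map_measureReal_apply (by fun_prop) hm]
  congr 1
  ext z
  simp only [Set.mem_preimage, Set.mem_ofPred_eq, abs_mul, abs_of_pos hr]
  rw [le_div_iff₀ hr, mul_comm]

lemma biNormal_zero_strip {u : ℝ} (hu : 0 ≤ u) : (biNormal 0).real (strip u) = Psi u := by
  rw [biNormal_strip le_rfl one_pos hu]
  simp

lemma empCdf_eq_hits_div {n : ℕ} (x : Fin n → ℝ × ℝ) (u : ℝ) :
    empCdf n x u = hits (strip u) x / n := by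
  classical
  rw [empCdf, hits, Finset.natCast_card_filter]
  congr 1

lemma strip_subset {u v : ℝ} (h : u ≤ v) : strip u ⊆ strip v := fun _ hz => le_trans hz h

end Gaussian

section NullHypothesis

lemma measureReal_le_hits_sub_le {Ω : Type*} [MeasurableSpace Ω] {n : ℕ} (μ : Measure Ω)
    [IsProbabilityMeasure μ] {S : Set Ω} (hS : MeasurableSet S) {V L : ℝ} (hL : 0 < L)
    (hV : V = n * μ.real S * (1 - μ.real S)) (hV4 : 1 / 4 ≤ V) :
    (Measure.pi fun _ : Fin n => μ).real {x | L * √V / 2 ≤ hits S x - n * μ.real S} ≤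
      Real.exp (-2 * L) + Real.exp (-L ^ 2 / (16 * expConst)) := by
  have hK : 0 < expConst := Real.exp_pos _
  have hr : 1 / 2 ≤ √V := Real.le_sqrt_of_sq_le (by norm_num; linarith)
  have hr0 : 0 < √V := by linarith
  have hrr : √V * √V = V := Real.mul_self_sqrt (by linarith)
  set s := L / (4 * expConst * √V) with hs
  have hs0 : 0 < s := by positivity
  have hsr : expConst * √V * s = L / 4 := by rw [hs]; field_simp
  set t := min 16 s with ht
  have ht0 : 0 < t := lt_min (by norm_num) hs0
  have hsub : {x : Fin n → Ω | L * √V / 2 ≤ hits S x - n * μ.real S} ⊆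
      {x | t * (L * √V / 2) ≤ t * (hits S x - n * μ.real S)} := fun x hx =>
    mul_le_mul_of_nonneg_left hx ht0.le
  refine (measureReal_mono hsub).trans ((measureReal_le_mul_hits_sub_le μ hS
    (by rw [abs_of_pos ht0]; exact min_le_left _ _) _).trans ?_)
  have hexp : expConst * (n * μ.real S * (1 - μ.real S)) * t ^ 2 - t * (L * √V / 2) ≤
      -(t * √V * L / 4) := by
    have : expConst * √V * t ≤ L / 4 := by
      rw [← hsr]
      exact mul_le_mul_of_nonneg_left (min_le_right _ _) (by positivity)
    rw [← hV]
    calc _ = (t * √V) * (expConst * √V * t) - t * (L * √V / 2) := by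
          nth_rewrite 1 [← hrr]; ring
      _ ≤ (t * √V) * (L / 4) - t * (L * √V / 2) := by gcongr
      _ = _ := by ring
  refine (Real.exp_le_exp.mpr hexp).trans ?_
  rcases min_choice 16 s with h | h
  · rw [← ht] at h
    rw [h]
    refine le_add_of_le_of_nonneg (Real.exp_le_exp.mpr ?_) (Real.exp_pos _).le
    nlinarith
  · rw [← ht] at h
    rw [h]
    refine le_add_of_nonneg_of_le (Real.exp_pos _).le (Real.exp_le_exp.mpr (le_of_eq ?_))
    rw [hs]
    field_simp
    ring

lemma hcTerm_eq {n : ℕ} (hn : 0 < n) (x : Fin n → ℝ × ℝ) (u : ℝ) :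
    √n * (empCdf n x u - Psi u) / √(Psi u * (1 - Psi u)) =
      (hits (strip u) x - n * Psi u) / √(n * (Psi u * (1 - Psi u))) := by
  have hn' : (0 : ℝ) < n := by exact_mod_cast hn
  have hr : √(n : ℝ) ≠ 0 := (Real.sqrt_pos.mpr hn').ne'
  have h : √(n : ℝ) * (hits (strip u) x / n - Psi u) = (hits (strip u) x - n * Psi u) / √n := by
    rw [eq_div_iff hr, mul_comm, ← mul_assoc, Real.mul_self_sqrt hn'.le]
    field_simp
  rw [empCdf_eq_hits_div, h, Real.sqrt_mul hn'.le, div_div]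

lemma quarter_le_mul_sub_div {n s : ℝ} (hn : 2 ≤ n) (h1 : 1 ≤ s) (h2 : s ≤ n - 1) :
    1 / 4 ≤ s * (1 - s / n) := by
  have hn0 : 0 < n := by linarith
  rw [show s * (1 - s / n) = s * (n - s) / n by field_simp, le_div_iff₀ hn0]
  nlinarith [mul_nonneg (sub_nonneg.mpr h1) (sub_nonneg.mpr h2)]

/-- Control of the number of hits along the quantiles `U (j / n)` and near the origin
controls the higher criticism statistic. -/
lemma HCstat_le_of_hits {n : ℕ} (hn : 2 ≤ n) {L : ℝ} (hL : 11 ≤ L) {U : ℝ → ℝ}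
    (hU : ∀ p, 0 ≤ p → p < 1 → Psi (U p) = p) {x : Fin n → ℝ × ℝ}
    (h0 : hits (strip (U (1 / (n * L)))) x < 1)
    (h1 : hits (strip (U (1 / n))) x < √L / 2)
    (h2 : ∀ j ∈ Finset.Ico 2 n, hits (strip (U (j / n))) x - j < L * √(j * (1 - j / n)) / 2) :
    HCstat n x ≤ 9 / 10 * L := by
  have hn2 : (2 : ℝ) ≤ n := by exact_mod_cast hn
  have hn0 : (0 : ℝ) < n := by linarith
  have hmono : ∀ u p, 0 ≤ p → p < 1 → Psi u < p →
      hits (strip u) x ≤ hits (strip (U p)) x := fun u p hp0 hp1 h =>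
    hits_mono (strip_subset (le_of_lt (Psi_mono.reflect_lt (by rwa [hU p hp0 hp1])))) x
  refine ciSup_le fun ⟨u, hu⟩ => ?_
  simp only
  rw [hcTerm_eq (by lia)]
  set t := Psi u with ht
  have ht0 : 0 ≤ t := Psi_nonneg hu
  have ht1 : t ≤ 1 := Psi_le_one u
  refine div_le_of_le_mul₀ (Real.sqrt_nonneg _) (by linarith) ?_
  set V := n * (t * (1 - t)) with hV
  have hV0 : 0 ≤ V := by have := sub_nonneg.mpr ht1; positivity
  have hN := hits_le (strip u) x
  rcases lt_or_ge (n * t) (1 / L) with ha | ha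
  · have hlt : t < 1 / (n * L) := by
      rw [lt_div_iff₀ (by positivity)]
      rw [lt_div_iff₀ (by positivity)] at ha
      linarith
    have hp1 : 1 / (n * L) < 1 := by
      rw [div_lt_one (by positivity)]
      nlinarith
    have := (hmono u _ (by positivity) hp1 hlt).trans (hits_eq_zero h0).le
    have : 0 ≤ 9 / 10 * L * √V := by positivity
    have : 0 ≤ n * t := by positivity
    linarith
  rcases lt_or_ge (n * t) 1 with hb | hb
  · have hlt : t < 1 / n := by rw [lt_div_iff₀ hn0]; linarith
    have hp1 : 1 / (n : ℝ) < 1 := by rw [div_lt_one hn0]; linarith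
    have hNu := hmono u _ (by positivity) hp1 hlt
    have hVL : 1 / (2 * L) ≤ V := by
      have : t ≤ 1 / 2 := hlt.le.trans (one_div_le_one_div_of_le two_pos hn2)
      calc 1 / (2 * L) = 1 / L * (1 / 2) := by field_simp
        _ ≤ (n * t) * (1 - t) := by gcongr; linarith
        _ = V := by rw [hV]; ring
    have : √L / 2 ≤ 9 / 10 * L * √V := by
      have h3 : √L ^ 2 = L := Real.sq_sqrt (by linarith)
      have h4 : √V ^ 2 = V := Real.sq_sqrt hV0
      refine (sq_le_sq₀ (by positivity) (by positivity)).mp ?_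
      rw [div_pow, h3, mul_pow, h4]
      rw [div_le_iff₀ (by positivity)] at hVL
      nlinarith
    have : 0 ≤ n * t := by positivity
    linarith
  rcases lt_or_ge (n * t) (n - 1) with hc | hc
  · set j := ⌊n * t⌋₊ + 1 with hj
    have hj1 : n * t < j := by rw [hj]; push_cast; exact Nat.lt_floor_add_one _
    have hj2 : (j : ℝ) ≤ n * t + 1 := by
      rw [hj]; push_cast; linarith [Nat.floor_le (show 0 ≤ n * t by positivity)]
    have hjn : j < n := by
      have : (j : ℝ) < n := by linarith
      exact_mod_cast this
    have hj0 : 2 ≤ j := by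
      have : 1 ≤ ⌊n * t⌋₊ := Nat.le_floor (by simpa using hb)
      lia
    have hjn' : (j : ℝ) < n := by exact_mod_cast hjn
    have hp1 : (j : ℝ) / n < 1 := by rwa [div_lt_one hn0]
    have htj : t < j / n := by rw [lt_div_iff₀ hn0]; linarith
    have hNu := hmono u _ (by positivity) hp1 htj
    have hgrid := h2 j (Finset.mem_Ico.mpr ⟨hj0, hjn⟩)
    have hVj : (j : ℝ) * (1 - j / n) ≤ 2 * V := by
      calc (j : ℝ) * (1 - j / n) ≤ (2 * (n * t)) * (1 - t) := by
            gcongr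
            linarith
        _ = 2 * V := by rw [hV]; ring
    have hV4 : 1 / 4 ≤ V := by
      have := quarter_le_mul_sub_div hn2 hb hc.le
      rwa [mul_div_cancel_left₀ _ hn0.ne', mul_assoc] at this
    have hr : 1 / 2 ≤ √V := Real.le_sqrt_of_sq_le (by norm_num; linarith)
    have hrj : √(j * (1 - j / n)) ≤ 10 / 7 * √V := by
      refine Real.sqrt_le_iff.mpr ⟨by positivity, ?_⟩
      rw [mul_pow, Real.sq_sqrt hV0]
      linarith
    nlinarith [mul_le_mul_of_nonneg_left hrj (show 0 ≤ L by linarith),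
      mul_le_mul_of_nonneg_left hr (show 0 ≤ L by linarith)]
  · have hr : n * (1 - t) ≤ 2 * √V := by
      have h5 : 0 ≤ n * (1 - t) := by have := sub_nonneg.mpr ht1; positivity
      refine (sq_le_sq₀ h5 (by positivity)).mp ?_
      rw [mul_pow 2, Real.sq_sqrt hV0, hV]
      have h3 : n * (1 - t) ≤ 1 := by linarith
      have h4 : 1 / 2 ≤ t := by nlinarith
      nlinarith [mul_nonneg h5 (sub_nonneg.mpr h3), mul_nonneg h5 (sub_nonneg.mpr h4)]
    nlinarith [Real.sqrt_nonneg V]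

lemma null_measureReal_le {n : ℕ} (hn : 2 ≤ n) {L : ℝ} (hL : 11 ≤ L) :
    (iid n (biNormal 0)).real {x | L ≤ HCstat n x} ≤
      1 / L + 2 / √L + n * (Real.exp (-2 * L) + Real.exp (-L ^ 2 / (16 * expConst))) := by
  have hn2 : (2 : ℝ) ≤ n := by exact_mod_cast hn
  have hn0 : (0 : ℝ) < n := by linarith
  have hL0 : 0 < L := by linarith
  have hex : ∀ p : ℝ, ∃ u, 0 ≤ p → p < 1 → 0 ≤ u ∧ Psi u = p := fun p => by
    by_cases h : 0 ≤ p ∧ p < 1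
    · obtain ⟨u, hu⟩ := exists_Psi_eq h.1 h.2
      exact ⟨u, fun _ _ => hu⟩
    · exact ⟨0, fun h0 h1 => absurd ⟨h0, h1⟩ h⟩
  choose U hU using hex
  have hprob : ∀ p, 0 ≤ p → p < 1 → (biNormal 0).real (strip (U p)) = p := fun p h0 h1 => by
    rw [biNormal_zero_strip (hU p h0 h1).1, (hU p h0 h1).2]
  have hp0 : 1 / (n * L) < 1 := by
    rw [div_lt_one (by positivity)]
    nlinarith
  have hp1 : 1 / (n : ℝ) < 1 := by rw [div_lt_one hn0]; linarith
  set A : Set (Fin n → ℝ × ℝ) := {x | 1 ≤ hits (strip (U (1 / (n * L)))) x} with hA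
  set B : Set (Fin n → ℝ × ℝ) := {x | √L / 2 ≤ hits (strip (U (1 / n))) x} with hB
  set G : ℕ → Set (Fin n → ℝ × ℝ) := fun j =>
    {x | L * √(j * (1 - j / n)) / 2 ≤ hits (strip (U (j / n))) x - j} with hG
  have hsub : {x | L ≤ HCstat n x} ⊆ (A ∪ B) ∪ ⋃ j ∈ Finset.Ico 2 n, G j := by
    intro x hx
    by_contra hcon
    simp only [Set.mem_union, Set.mem_iUnion, not_or, not_exists, hA, hB, hG, Set.mem_ofPred_eq,
      not_le] at hcon
    have := HCstat_le_of_hits hn hL (fun p h0 h1 => (hU p h0 h1).2) hcon.1.1 hcon.1.2 hcon.2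
    have hx' : L ≤ HCstat n x := hx
    linarith
  have hPA : (iid n (biNormal 0)).real A ≤ 1 / L := by
    refine (measureReal_le_hits_le _ (measurableSet_strip _) one_pos).trans (le_of_eq ?_)
    rw [hprob _ (by positivity) hp0]
    field_simp
  have hPB : (iid n (biNormal 0)).real B ≤ 2 / √L := by
    refine (measureReal_le_hits_le _ (measurableSet_strip _) (by positivity)).trans (le_of_eq ?_)
    rw [hprob _ (by positivity) hp1]
    field_simp
  have hPG : ∀ j ∈ Finset.Ico 2 n, (iid n (biNormal 0)).real (G j) ≤
      Real.exp (-2 * L) + Real.exp (-L ^ 2 / (16 * expConst)) := fun j hj => by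
    obtain ⟨hj2, hjn⟩ := Finset.mem_Ico.mp hj
    have hj2' : (2 : ℝ) ≤ j := by exact_mod_cast hj2
    have hjn' : (j : ℝ) + 1 ≤ n := by exact_mod_cast hjn
    have hp : (biNormal 0).real (strip (U (j / n))) = j / n :=
      hprob _ (by positivity) (by rw [div_lt_one hn0]; linarith)
    have hnp : n * (biNormal 0).real (strip (U (j / n))) = j := by
      rw [hp, mul_div_cancel₀ _ hn0.ne']
    have := measureReal_le_hits_sub_le (n := n) (biNormal 0) (measurableSet_strip (U (j / n)))
      (V := j * (1 - j / n)) hL0 (by rw [hnp, hp])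
      (quarter_le_mul_sub_div hn2 (by linarith) (by linarith))
    rwa [hnp] at this
  have : IsProbabilityMeasure (iid n (biNormal 0)) := by unfold iid; infer_instance
  calc (iid n (biNormal 0)).real {x | L ≤ HCstat n x}
      ≤ (iid n (biNormal 0)).real ((A ∪ B) ∪ ⋃ j ∈ Finset.Ico 2 n, G j) := measureReal_mono hsub
    _ ≤ (iid n (biNormal 0)).real A + (iid n (biNormal 0)).real B +
          ∑ j ∈ Finset.Ico 2 n, (iid n (biNormal 0)).real (G j) :=
        (measureReal_union_le _ _).trans
          (add_le_add (measureReal_union_le _ _) (measureReal_biUnion_finset_le _ _))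
    _ ≤ 1 / L + 2 / √L + ∑ _j ∈ Finset.Ico 2 n,
          (Real.exp (-2 * L) + Real.exp (-L ^ 2 / (16 * expConst))) :=
        add_le_add (add_le_add hPA hPB) (Finset.sum_le_sum hPG)
    _ ≤ _ := by
        rw [Finset.sum_const, nsmul_eq_mul, Nat.card_Ico]
        gcongr
        exact Nat.sub_le _ _

lemma tendsto_null_measureReal :
    Tendsto (fun n : ℕ => (iid n (biNormal 0)).real {x | Real.log n ≤ HCstat n x})
      atTop (𝓝 0) := by
  have hK : 0 < expConst := Real.exp_pos _
  have hlog : Tendsto (fun n : ℕ => Real.log n) atTop atTop :=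
    Real.tendsto_log_atTop.comp tendsto_natCast_atTop_atTop
  have hlim : Tendsto (fun L : ℝ => 1 / L + 2 / √L +
      (Real.exp (-L) + Real.exp (L * (1 - L / (16 * expConst))))) atTop (𝓝 0) := by
    have h1 : Tendsto (fun L : ℝ => 1 / L) atTop (𝓝 0) := tendsto_const_nhds.div_atTop tendsto_id
    have h2 : Tendsto (fun L : ℝ => 2 / √L) atTop (𝓝 0) :=
      tendsto_const_nhds.div_atTop Real.tendsto_sqrt_atTop
    have h3 : Tendsto (fun L : ℝ => Real.exp (-L)) atTop (𝓝 0) :=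
      Real.tendsto_exp_neg_atTop_nhds_zero
    have h4 : Tendsto (fun L : ℝ => Real.exp (L * (1 - L / (16 * expConst)))) atTop (𝓝 0) := by
      refine Real.tendsto_exp_atBot.comp (tendsto_id.atTop_mul_atBot₀ ?_)
      exact tendsto_atBot_add_const_left _ 1
        (tendsto_neg_atTop_atBot.comp (tendsto_id.atTop_div_const (by positivity)))
    simpa using (h1.add h2).add (h3.add h4)
  refine squeeze_zero' (Eventually.of_forall fun n => measureReal_nonneg) ?_ (hlim.comp hlog)
  filter_upwards [eventually_ge_atTop 2, hlog.eventually_ge_atTop 11] with n hn hL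
  refine (null_measureReal_le hn hL).trans (le_of_eq ?_)
  have hn0 : (0 : ℝ) < n := by exact_mod_cast (show 0 < n by lia)
  simp only [Function.comp]
  congr 1
  nth_rewrite 1 [← Real.exp_log hn0]
  rw [mul_add, ← Real.exp_add, ← Real.exp_add]
  congr 2
  · ring
  · field_simp
    ring

end NullHypothesis

section Alternative

lemma pairDiff_abs_pos {n : ℕ} {x : Fin n → ℝ × ℝ} (h : hits (strip 0) x = 0) (i : Fin n) :
    0 < |pairDiff n x i| := by
  by_contra! hi
  have hmem : x i ∈ strip 0 := hi
  have := (Finset.sum_eq_zero_iff_of_nonneg fun j _ => indicator_one_nonneg (strip 0) (x j)).mp h i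
    (Finset.mem_univ i)
  simp [hmem] at this

lemma bddAbove_hcTerm {n : ℕ} (hn : 0 < n) {x : Fin n → ℝ × ℝ} (h : hits (strip 0) x = 0) :
    BddAbove (Set.range fun u : {u : ℝ // 0 ≤ u} =>
      √n * (empCdf n x u.1 - Psi u.1) / √(Psi u.1 * (1 - Psi u.1))) := by
  obtain ⟨m, hm, hm0⟩ : ∃ m, (∀ i, m < |pairDiff n x i|) ∧ 0 < m := by
    have h1 : ∀ᶠ m in 𝓝[>] (0 : ℝ), ∀ i, m < |pairDiff n x i| := eventually_all.mpr fun i =>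
      nhdsWithin_le_nhds (eventually_lt_nhds (pairDiff_abs_pos h i))
    exact (h1.and self_mem_nhdsWithin).exists
  have hc := Psi_pos hm0
  refine ⟨√(n / Psi m), ?_⟩
  rintro _ ⟨⟨u, hu⟩, rfl⟩
  simp only
  rw [hcTerm_eq hn]
  have ht0 : 0 ≤ Psi u := Psi_nonneg hu
  have ht1 : 0 ≤ 1 - Psi u := sub_nonneg.mpr (Psi_le_one u)
  refine div_le_of_le_mul₀ (Real.sqrt_nonneg _) (Real.sqrt_nonneg _) ?_
  rcases lt_or_ge u m with hum | hum
  · have : hits (strip u) x = 0 := Finset.sum_eq_zero fun i _ =>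
      Set.indicator_of_notMem (show x i ∉ strip u from fun hi =>
        absurd (hm i) (not_lt.mpr (le_trans (show |pairDiff n x i| ≤ u from hi) hum.le))) _
    rw [this]
    have : 0 ≤ √(n / Psi m) * √(n * (Psi u * (1 - Psi u))) := by positivity
    have : 0 ≤ n * Psi u := by positivity
    linarith
  · have hN := hits_le (strip u) x
    rw [← Real.sqrt_mul (by positivity)]
    calc hits (strip u) x - n * Psi u ≤ n * (1 - Psi u) := by linarith
      _ ≤ _ := by
        refine Real.le_sqrt_of_sq_le ?_
        rw [div_mul_eq_mul_div, le_div_iff₀ hc]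
        have : (1 - Psi u) * Psi m ≤ 1 * Psi u :=
          mul_le_mul (by linarith) (Psi_mono hum) hc.le zero_le_one
        have hnn : 0 ≤ (n : ℝ) ^ 2 * (1 - Psi u) := by positivity
        nlinarith [mul_le_mul_of_nonneg_left this hnn]

lemma le_HCstat_of_hits {n : ℕ} (hn : 0 < n) {x : Fin n → ℝ × ℝ} (h0 : hits (strip 0) x = 0)
    {u L : ℝ} (hu : 0 < u) (hu1 : u < 1) (hL : 0 ≤ L)
    (h : n * Psi u + L * √(n * u) ≤ hits (strip u) x) : L ≤ HCstat n x := by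
  refine le_trans ?_ (le_ciSup (bddAbove_hcTerm hn h0) ⟨u, hu.le⟩)
  simp only
  have hP0 := Psi_pos hu
  have hPu := Psi_le_self hu.le
  have hn0 : (0 : ℝ) < n := by exact_mod_cast hn
  have hP1 : 0 < 1 - Psi u := by linarith
  rw [hcTerm_eq hn, le_div_iff₀ (Real.sqrt_pos.mpr (by positivity))]
  have : √(n * (Psi u * (1 - Psi u))) ≤ √(n * u) := by
    refine Real.sqrt_le_sqrt (mul_le_mul_of_nonneg_left ?_ hn0.le)
    nlinarith
  nlinarith [mul_le_mul_of_nonneg_left this hL]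

lemma isProbabilityMeasure_mixture {ε : ℝ} (h0 : 0 ≤ ε) (h1 : ε ≤ 1) (ρ : ℝ) :
    IsProbabilityMeasure (mixture ε ρ) := by
  refine ⟨?_⟩
  simp only [mixture, Measure.add_apply, Measure.smul_apply, measure_univ, smul_eq_mul, mul_one]
  rw [← ENNReal.ofReal_add (by linarith) h0]
  simp

lemma mixture_strip {ε ρ u : ℝ} (h0 : 0 ≤ ε) (h1 : ε ≤ 1) (hρ0 : 0 ≤ ρ) (hρ1 : ρ < 1)
    (hu : 0 ≤ u) :
    (mixture ε ρ).real (strip u) = (1 - ε) * Psi u + ε * Psi (u / √(1 - ρ)) := by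
  rw [← biNormal_zero_strip hu, ← biNormal_strip hρ0 hρ1 hu, mixture,
    measureReal_add_apply (h₁ := ENNReal.mul_ne_top ENNReal.ofReal_ne_top (measure_ne_top _ _))
      (h₂ := ENNReal.mul_ne_top ENNReal.ofReal_ne_top (measure_ne_top _ _)),
    measureReal_ennreal_smul_apply, measureReal_ennreal_smul_apply,
    ENNReal.toReal_ofReal (by linarith), ENNReal.toReal_ofReal h0]

lemma one_sub_alternative_measureReal_le {n : ℕ} (hn : 0 < n) {ε ρ L : ℝ} (hε0 : 0 < ε)
    (hε1 : ε ≤ 1) (hρ0 : 0 ≤ ρ) (hρ1 : ρ < 1) (hL : 0 ≤ L) (hσ : √(1 - ρ) ≤ Psi 1 / 2)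
    (hlarge : L * √(n * √(1 - ρ)) ≤ n * ε * Psi 1 / 4) :
    1 - (iid n (mixture ε ρ)).real {x | L ≤ HCstat n x} ≤
      Real.exp (-(Psi 1 ^ 2 / (64 * expConst)) * (n * ε ^ 2 / (√(1 - ρ) + ε))) := by
  set σ := √(1 - ρ) with hσdef
  set c := Psi 1 with hcdef
  have hK : 0 < expConst := Real.exp_pos _
  have hK1 := one_le_expConst
  have hσ0 : 0 < σ := Real.sqrt_pos.mpr (by linarith)
  have hc0 : 0 < c := Psi_pos one_pos
  have hc1 : c ≤ 1 := Psi_le_one 1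
  have hn0 : (0 : ℝ) < n := by exact_mod_cast hn
  have : IsProbabilityMeasure (mixture ε ρ) := isProbabilityMeasure_mixture hε0.le hε1 ρ
  have : IsProbabilityMeasure (iid n (mixture ε ρ)) := by unfold iid; infer_instance
  set q := (mixture ε ρ).real (strip σ) with hq
  have hqv : q = (1 - ε) * Psi σ + ε * c := by
    rw [hq, mixture_strip hε0.le hε1 hρ0 hρ1 hσ0.le, div_self hσ0.ne']
  have hPσ : Psi σ ≤ σ := Psi_le_self hσ0.le
  have hPσ0 : 0 < Psi σ := Psi_pos hσ0
  have hqle : q * (1 - q) ≤ σ + ε := by nlinarith [sq_nonneg q]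
  set a := n * ε * c / 4 with ha
  set s := a / (2 * expConst * n * (σ + ε)) with hs
  have ha0 : 0 < a := by positivity
  have hs0 : 0 < s := by positivity
  have hs16 : |-s| ≤ 16 := by
    rw [abs_neg, abs_of_pos hs0, hs, div_le_iff₀ (by positivity), ha]
    have h1 : ε * c ≤ expConst * (σ + ε) := by nlinarith
    nlinarith [mul_le_mul_of_nonneg_left h1 hn0.le, mul_pos hn0 (mul_pos hε0 hc0)]
  set A : Set (Fin n → ℝ × ℝ) := {x | 1 ≤ hits (strip 0) x} with hA
  set B : Set (Fin n → ℝ × ℝ) := {x | s * a ≤ -s * (hits (strip σ) x - n * q)} with hB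
  have hcover : (Set.univ : Set (Fin n → ℝ × ℝ)) ⊆ {x | L ≤ HCstat n x} ∪ (A ∪ B) := by
    intro x _
    by_contra hcon
    simp only [Set.mem_union, not_or, hA, hB, Set.mem_ofPred_eq, not_le] at hcon
    obtain ⟨hx, hxA, hxB⟩ := hcon
    have hdev : -a < hits (strip σ) x - n * q := by nlinarith
    have hgap : n * ε * c / 2 ≤ n * q - n * Psi σ := by
      have h1 : c / 2 ≤ c - Psi σ := by linarith
      have := mul_le_mul_of_nonneg_left h1 (show 0 ≤ n * ε by positivity)
      rw [hqv]
      linarith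
    exact absurd (le_HCstat_of_hits hn (hits_eq_zero hxA) hσ0 (by linarith) hL (by linarith))
      (not_le.mpr hx)
  have hPA : (iid n (mixture ε ρ)).real A ≤ 0 := by
    refine (measureReal_le_hits_le _ (measurableSet_strip _) one_pos).trans (le_of_eq ?_)
    rw [mixture_strip hε0.le hε1 hρ0 hρ1 le_rfl]
    simp [Psi_zero]
  have hPB : (iid n (mixture ε ρ)).real B ≤
      Real.exp (-(c ^ 2 / (64 * expConst)) * (n * ε ^ 2 / (σ + ε))) := by
    refine (measureReal_le_mul_hits_sub_le _ (measurableSet_strip _) hs16 _).trans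
      (Real.exp_le_exp.mpr ?_)
    calc expConst * (n * q * (1 - q)) * (-s) ^ 2 - s * a
        = expConst * n * s ^ 2 * (q * (1 - q)) - s * a := by ring
      _ ≤ expConst * n * s ^ 2 * (σ + ε) - s * a := by gcongr
      _ = _ := by
        rw [hs, ha]
        field_simp
        ring
  have htot : 1 ≤ (iid n (mixture ε ρ)).real {x | L ≤ HCstat n x} +
      ((iid n (mixture ε ρ)).real A + (iid n (mixture ε ρ)).real B) := by
    calc (1 : ℝ) = (iid n (mixture ε ρ)).real Set.univ := probReal_univ.symm
      _ ≤ _ := (measureReal_mono hcover).trans ((measureReal_union_le _ _).trans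
          (add_le_add le_rfl (measureReal_union_le _ _)))
  linarith

lemma sqrt_rpow_neg (n : ℕ) (γ : ℝ) : √((n : ℝ) ^ (-γ)) = (n : ℝ) ^ (-γ / 2) := by
  rw [Real.sqrt_eq_rpow, ← Real.rpow_mul n.cast_nonneg]
  congr 1
  ring

lemma tendsto_natCast_rpow_neg {r : ℝ} (hr : r < 0) :
    Tendsto (fun n : ℕ => (n : ℝ) ^ r) atTop (𝓝 0) := by
  have := (tendsto_rpow_neg_atTop (neg_pos.mpr hr)).comp tendsto_natCast_atTop_atTop
  rwa [neg_neg] at this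

lemma tendsto_one_sub_alternative {β γ : ℝ} (hβ0 : 1 / 2 < β) (hβ1 : β < 1)
    (hsparse : 4 * (β - 1 / 2) < γ) :
    Tendsto (fun n : ℕ => 1 - (iid n (mixture ((n : ℝ) ^ (-β)) (1 - (n : ℝ) ^ (-γ)))).real
      {x | Real.log n ≤ HCstat n x}) atTop (𝓝 0) := by
  have hK : 0 < expConst := Real.exp_pos _
  have hc0 : 0 < Psi 1 := Psi_pos one_pos
  have hrate : Tendsto (fun n : ℕ => (n : ℝ) * ((n : ℝ) ^ (-β)) ^ 2 /
      ((n : ℝ) ^ (-γ / 2) + (n : ℝ) ^ (-β))) atTop atTop := by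
    have h1 : Tendsto (fun n : ℕ => (n : ℝ) ^ (2 * β - 1 - γ / 2) + (n : ℝ) ^ (β - 1))
        atTop (𝓝[>] 0) := by
      refine tendsto_nhdsWithin_iff.mpr ⟨?_, ?_⟩
      · simpa using (tendsto_natCast_rpow_neg (by linarith)).add
          (tendsto_natCast_rpow_neg (r := β - 1) (by linarith))
      · filter_upwards [eventually_gt_atTop 0] with n hn
        have hn0 : (0 : ℝ) < n := by exact_mod_cast hn
        exact add_pos (Real.rpow_pos_of_pos hn0 _) (Real.rpow_pos_of_pos hn0 _)
    refine h1.inv_tendsto_nhdsGT_zero.congr' ?_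
    filter_upwards [eventually_gt_atTop 0] with n hn
    have hn0 : (0 : ℝ) < n := by exact_mod_cast hn
    have e1 : (n : ℝ) ^ (2 * β - 1 - γ / 2) * (n * ((n : ℝ) ^ (-β)) ^ 2) = (n : ℝ) ^ (-γ / 2) := by
      rw [← Real.rpow_natCast, ← Real.rpow_mul hn0.le, ← Real.rpow_one_add' hn0.le (by
        push_cast; linarith), ← Real.rpow_add hn0]
      congr 1
      push_cast
      ring
    have e2 : (n : ℝ) ^ (β - 1) * (n * ((n : ℝ) ^ (-β)) ^ 2) = (n : ℝ) ^ (-β) := by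
      rw [← Real.rpow_natCast, ← Real.rpow_mul hn0.le, ← Real.rpow_one_add' hn0.le (by
        push_cast; linarith), ← Real.rpow_add hn0]
      congr 1
      push_cast
      ring
    have hp1 := Real.rpow_pos_of_pos hn0 (2 * β - 1 - γ / 2)
    have hp2 := Real.rpow_pos_of_pos hn0 (β - 1)
    have hw : 0 < n * ((n : ℝ) ^ (-β)) ^ 2 := by
      have := Real.rpow_pos_of_pos hn0 (-β)
      positivity
    have hden : (n : ℝ) ^ (-γ / 2) + (n : ℝ) ^ (-β) =
        ((n : ℝ) ^ (2 * β - 1 - γ / 2) + (n : ℝ) ^ (β - 1)) * (n * ((n : ℝ) ^ (-β)) ^ 2) := by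
      rw [add_mul, e1, e2]
    rw [hden, Pi.inv_apply, eq_div_iff (by positivity), inv_mul_cancel_left₀ (by positivity)]
  have hlim : Tendsto (fun n : ℕ => Real.exp (-(Psi 1 ^ 2 / (64 * expConst)) *
      ((n : ℝ) * ((n : ℝ) ^ (-β)) ^ 2 / ((n : ℝ) ^ (-γ / 2) + (n : ℝ) ^ (-β)))))
      atTop (𝓝 0) :=
    Real.tendsto_exp_atBot.comp (hrate.const_mul_atTop_of_neg (neg_neg_of_pos (by positivity)))
  have hσ : ∀ᶠ n : ℕ in atTop, (n : ℝ) ^ (-γ / 2) ≤ Psi 1 / 2 :=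
    (tendsto_natCast_rpow_neg (by linarith)).eventually_le_const (by positivity)
  have hlog : ∀ᶠ n : ℕ in atTop,
      Real.log n ≤ Psi 1 / 4 * (n : ℝ) ^ (1 / 2 - β + γ / 4) := by
    have := ((isLittleO_log_rpow_atTop (r := 1 / 2 - β + γ / 4) (by linarith)).comp_tendsto
      tendsto_natCast_atTop_atTop).def (c := Psi 1 / 4) (by positivity)
    filter_upwards [this] with n hn
    refine (le_abs_self _).trans (hn.trans (le_of_eq ?_))
    simp only [Function.comp]
    rw [Real.norm_of_nonneg (by positivity)]
  refine squeeze_zero' ?_ ?_ hlim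
  · filter_upwards [eventually_gt_atTop 0] with n hn
    have hn1 : (1 : ℝ) ≤ n := by exact_mod_cast hn
    have : IsProbabilityMeasure (mixture ((n : ℝ) ^ (-β)) (1 - (n : ℝ) ^ (-γ))) :=
      isProbabilityMeasure_mixture (by positivity)
        (Real.rpow_le_one_of_one_le_of_nonpos hn1 (by linarith)) _
    have : IsProbabilityMeasure (iid n (mixture ((n : ℝ) ^ (-β)) (1 - (n : ℝ) ^ (-γ)))) := by
      unfold iid; infer_instance
    exact sub_nonneg.mpr measureReal_le_one
  · filter_upwards [eventually_gt_atTop 0, hσ, hlog] with n hn hσn hlogn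
    have hn1 : (1 : ℝ) ≤ n := by exact_mod_cast hn
    have hn0 : (0 : ℝ) < n := by linarith
    have hroot : √(1 - (1 - (n : ℝ) ^ (-γ))) = (n : ℝ) ^ (-γ / 2) := by
      rw [sub_sub_cancel, sqrt_rpow_neg]
    have hlarge : Real.log n * √(n * (n : ℝ) ^ (-γ / 2)) ≤ n * (n : ℝ) ^ (-β) * Psi 1 / 4 := by
      have e1 : √(n * (n : ℝ) ^ (-γ / 2)) = (n : ℝ) ^ (1 / 2 - γ / 4) := by
        rw [Real.sqrt_eq_rpow]
        nth_rewrite 1 [← Real.rpow_one (n : ℝ)]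
        rw [← Real.rpow_add hn0, ← Real.rpow_mul hn0.le]
        congr 1
        ring
      have e2 : (n : ℝ) * (n : ℝ) ^ (-β) =
          (n : ℝ) ^ (1 / 2 - β + γ / 4) * (n : ℝ) ^ (1 / 2 - γ / 4) := by
        nth_rewrite 1 [← Real.rpow_one (n : ℝ)]
        rw [← Real.rpow_add hn0, ← Real.rpow_add hn0]
        congr 1
        ring
      rw [e1, e2]
      calc _ ≤ Psi 1 / 4 * (n : ℝ) ^ (1 / 2 - β + γ / 4) * (n : ℝ) ^ (1 / 2 - γ / 4) := by gcongr
        _ = _ := by ring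
    have := one_sub_alternative_measureReal_le (n := n) hn (ε := (n : ℝ) ^ (-β))
      (ρ := 1 - (n : ℝ) ^ (-γ)) (L := Real.log n) (Real.rpow_pos_of_pos hn0 _)
      (Real.rpow_le_one_of_one_le_of_nonpos hn1 (by linarith))
      (sub_nonneg.mpr (Real.rpow_le_one_of_one_le_of_nonpos hn1 (by linarith)))
      (sub_lt_self _ (Real.rpow_pos_of_pos hn0 _)) (Real.log_nonneg hn1)
      (by rwa [hroot]) (by rwa [hroot])
    rwa [hroot] at this

end Alternative

/-- in the sparse regime with `γ > 4(β - 1/2)`, the higher criticism test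
rejecting when `HCₙ ≥ log n` is asymptotically powerful. -/
theorem HC_sparse_powerful (β γ : ℝ) (hβ0 : 1 / 2 < β) (hβ1 : β < 1) (hγ0 : 0 < γ)
    (hsparse : 4 * (β - 1 / 2) < γ)
    (ε ρ : ℕ → ℝ) (hε : ∀ n : ℕ, ε n = (n : ℝ) ^ (-β))
    (hρ : ∀ n : ℕ, ρ n = 1 - (n : ℝ) ^ (-γ)) :
    Tendsto (fun n =>
      ((iid n (biNormal 0)) {x : Fin n → ℝ × ℝ | Real.log n ≤ HCstat n x}).toReal
        + (1 - ((iid n (mixture (ε n) (ρ n)))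
            {x : Fin n → ℝ × ℝ | Real.log n ≤ HCstat n x}).toReal))
      atTop (𝓝 0) := by
  have h := tendsto_null_measureReal.add (tendsto_one_sub_alternative hβ0 hβ1 hsparse)
  simp only [hε, hρ]
  simpa only [measureReal_def, add_zero] using h
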